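/- For k ≥ 2, let T be a feasible connected digraph of order k, and suppose rₙ → 0 as n → ∞. Then n^{−k}·rₙ^{−2(k−1)}·E[H_{n,T}] → μ_T as n → ∞. -/

import Mathlib

open MeasureTheory ProbabilityTheory Filter Real Set
open scoped Topology

noncomputable section

/-- The circular sector with apex `x`, radius `r`, central angle `a` and
inclination `y` (measured anticlockwise from the horizontal direction). -/
def sector (a : ℝ) (x : ℂ) (y r : ℝ) : Set ℂ :=
  {z : ℂ | ‖z - x‖ ≤ r ∧
    ∃ t : ℝ, y ≤ t ∧ t ≤ y + a ∧
      z - x = (‖z - x‖ : ℂ) * Complex.exp (t * Complex.I)}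

/-- Arc relation of the sector digraph on the configuration `x` (points) and `y`
(inclinations) with cutoff `r`: there is an arc from `i` to `j` iff `i ≠ j` and
the point `x j` lies in the sector of `i`. -/
def arc (a r : ℝ) {n : ℕ} (x : Fin n → ℂ) (y : Fin n → ℝ) (i j : Fin n) : Prop :=
  i ≠ j ∧ x j ∈ sector a (x i) (y i) r

/-- The sector digraph (cutoff `r`) on the `k`-point configuration `(x, y)` is
isomorphic to the digraph `T` on `Fin k`. -/
def isoT (a r : ℝ) {k : ℕ} (T : Fin k → Fin k → Prop) (x : Fin k → ℂ) (y : Fin k → ℝ) : Prop :=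
  ∃ e : Equiv.Perm (Fin k), ∀ i j, T i j ↔ arc a r x y (e i) (e j)

/-- The number of induced subdigraphs of the sector digraph on the configuration
`(x, y)` with cutoff `r` that are isomorphic to `T`. -/
def inducedCount (a r : ℝ) {k : ℕ} (T : Fin k → Fin k → Prop) {n : ℕ}
    (x : Fin n → ℂ) (y : Fin n → ℝ) : ℕ :=
  Set.ncard {s : Finset (Fin n) |
    ∃ g : Fin k ↪ Fin n, Finset.univ.map g = s ∧
      ∀ i j, T i j ↔ arc a r x y (g i) (g j)}

/-- The number of isolated induced subdigraphs of the sector digraph on the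
configuration `(x, y)` with cutoff `r` that are isomorphic to `T`: `k`-element
vertex subsets inducing a digraph isomorphic to `T` with no arc leaving the subset. -/
def isolatedCount (a r : ℝ) {k : ℕ} (T : Fin k → Fin k → Prop) {n : ℕ}
    (x : Fin n → ℂ) (y : Fin n → ℝ) : ℕ :=
  Set.ncard {s : Finset (Fin n) |
    (∃ g : Fin k ↪ Fin n, Finset.univ.map g = s ∧
      ∀ i j, T i j ↔ arc a r x y (g i) (g j)) ∧
    ∀ i ∈ s, ∀ j, j ∉ s → ¬ arc a r x y i j}

open Classical in
/-- The indicator function `h_T`: equal to `1` if the sector digraph with radius `1`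
on the configuration `(x, y)` is isomorphic to `T`, and `0` otherwise. -/
def hInd (a : ℝ) {k : ℕ} (T : Fin k → Fin k → Prop) (x : Fin k → ℂ) (y : Fin k → ℝ) : ℝ :=
  if isoT a 1 T x y then 1 else 0

/-- The `k`-point configuration `(0, z 1, …, z (k-1))`. -/
def pts {k : ℕ} (z : Fin (k - 1) → ℂ) (i : Fin k) : ℂ :=
  if h : (i : ℕ) = 0 then 0 else z ⟨(i : ℕ) - 1, by have := i.isLt; omega⟩

/-- The Lebesgue measure of `S(x₁,…,x_k,y₁,…,y_k) = ∪_{i=1}^k S(xᵢ,yᵢ,1)`. -/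
def sectorUnionVol (a : ℝ) {k : ℕ} (x : Fin k → ℂ) (y : Fin k → ℝ) : ℝ :=
  (volume (⋃ i, sector a (x i) (y i) 1)).toReal

/-- The function `φ_T`. -/
def phiT (a : ℝ) (k : ℕ) (T : Fin k → Fin k → Prop) (t : ℝ) : ℝ :=
  if k = 1 then Real.exp (-(t * a) / 2)
  else (t ^ (k - 1) / ((k - 1).factorial * (2 * π) ^ k)) *
    ∫ y in Set.univ.pi (fun _ : Fin k => Set.Ico 0 (2 * π)),
      ∫ z : Fin (k - 1) → ℂ,
        hInd a T (pts z) y * Real.exp (-t * sectorUnionVol a (pts z) y)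

/-- The constant `μ_T`. -/
def muT (a : ℝ) (k : ℕ) (T : Fin k → Fin k → Prop) (f : ℂ → ℝ) : ℝ :=
  (1 / (k.factorial * (2 * π) ^ k)) *
    ∫ y in Set.univ.pi (fun _ : Fin k => Set.Ico 0 (2 * π)),
      ∫ z : Fin (k - 1) → ℂ, ∫ x : ℂ, hInd a T (pts z) y * f x ^ k

lemma lint_prod {α : Type*} [MeasurableSpace α] (μ : Measure α) [SigmaFinite μ] :
    ∀ {n : ℕ} (f : Fin n → α → ENNReal) (_ : ∀ i, Measurable (f i)),
    ∫⁻ x, ∏ i, f i (x i) ∂(Measure.pi (fun _ : Fin n => μ)) = ∏ i, ∫⁻ x, f i x ∂μ := by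
  intro n
  induction n with
  | zero => intro f _; simp
  | succ n ih =>
    intro f hf
    have h := (measurePreserving_piFinSuccAbove (fun _ : Fin (n+1) => μ) 0).symm
    rw [← h.lintegral_comp_emb (MeasurableEquiv.measurableEmbedding _)]
    simp only [Fin.prod_univ_succ]
    rw [← ih (fun i => f i.succ) (fun i => hf _)]
    rw [← lintegral_prod_mul (hf 0).aemeasurable]
    · rfl
    · apply Measurable.aemeasurable
      exact Finset.measurable_fun_prod _ (fun i _ => (hf i.succ).comp (measurable_pi_apply i))

lemma pi_wd {α : Type*} [MeasurableSpace α] (μ : Measure α) [SigmaFinite μ] {n : ℕ}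
    (f : α → ENNReal) (hf : Measurable f) [SigmaFinite (μ.withDensity f)] :
    Measure.pi (fun _ : Fin n => μ.withDensity f) =
      (Measure.pi (fun _ : Fin n => μ)).withDensity (fun x => ∏ i, f (x i)) := by
  refine Measure.pi_eq fun s hs => ?_
  rw [withDensity_apply _ (MeasurableSet.univ_pi hs), Measure.restrict_pi_pi]
  have : ∀ i, μ.withDensity f (s i) = ∫⁻ x, (s i).indicator f x ∂μ := by
    intro i
    rw [withDensity_apply _ (hs i), lintegral_indicator (hs i)]
  simp_rw [this]
  rw [← lint_prod μ _ (fun i => hf.indicator (hs i)), ← Measure.restrict_pi_pi,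
    ← lintegral_indicator (MeasurableSet.univ_pi hs)]
  congr 1
  ext x
  by_cases hx : x ∈ univ.pi s
  · rw [indicator_of_mem hx]
    exact Finset.prod_congr rfl fun i _ => by rw [indicator_of_mem (hx i (mem_univ i))]
  · rw [indicator_of_notMem hx]
    simp only [Set.mem_pi, not_forall] at hx
    obtain ⟨i, _, hi⟩ := hx
    exact (Finset.prod_eq_zero (Finset.mem_univ i) (by rw [indicator_of_notMem hi])).symm

lemma pi_smul' {α : Type*} [MeasurableSpace α] (μ : Measure α) [SigmaFinite μ] {n : ℕ}
    (c : ENNReal) [SigmaFinite (c • μ)] :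
    Measure.pi (fun _ : Fin n => c • μ) = c ^ n • Measure.pi (fun _ : Fin n => μ) := by
  refine Measure.pi_eq fun s hs => ?_
  simp [Measure.pi_pi, Finset.prod_mul_distrib]

lemma stepB {n : ℕ} (g : ℂ → ENNReal) (hg : Measurable g) [IsFiniteMeasure ((volume : Measure ℂ).withDensity g)]
    (c : ENNReal) (hc : c ≠ ⊤) (I : Set ℝ) (hI : volume I ≠ ⊤)
    (E : Set ((Fin n → ℂ) × (Fin n → ℝ))) (hE : MeasurableSet E) :
    Measure.pi (fun _ : Fin n => ((volume : Measure ℂ).withDensity g).prod (c • volume.restrict I))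
      {w | ((fun i => (w i).1), (fun i => (w i).2)) ∈ E} =
    c ^ n * ∫⁻ y in Set.univ.pi (fun _ : Fin n => I), ∫⁻ x : Fin n → ℂ,
      E.indicator 1 (x, y) * ∏ i, g (x i) := by
  have : IsFiniteMeasure (volume.restrict I) := ⟨by simpa using hI.lt_top⟩
  have : IsFiniteMeasure (c • volume.restrict I) := Measure.smul_finite _ hc
  have h := measurePreserving_arrowProdEquivProdArrow ℂ ℝ (Fin n)
    (fun _ => (volume : Measure ℂ).withDensity g) (fun _ => c • volume.restrict I)
  have h1 := h.measure_preimage hE.nullMeasurableSet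
  have h2 : ((MeasurableEquiv.arrowProdEquivProdArrow ℂ ℝ (Fin n)) ⁻¹' E) =
     {w | ((fun i => (w i).1), (fun i => (w i).2)) ∈ E} := rfl
  rw [h2] at h1
  have hgm : Measurable fun x : Fin n → ℂ => ∏ i, g (x i) :=
    Finset.measurable_fun_prod _ (fun i _ => hg.comp (measurable_pi_apply i))
  rw [h1, pi_wd _ _ hg, pi_smul', ← Measure.restrict_pi_pi, ← volume_pi, ← volume_pi,
    Measure.prod_smul_right, Measure.smul_apply, smul_eq_mul]
  congr 1
  have : SFinite ((volume : Measure (Fin n → ℂ)).withDensity fun x ↦ ∏ i, g (x i)) := by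
    infer_instance
  rw [Measure.prod_apply_symm hE]
  congr 1
  ext y
  have hEy : MeasurableSet ((fun x : Fin n → ℂ => (x, y)) ⁻¹' E) := hE.preimage (by fun_prop)
  rw [withDensity_apply _ hEy, ← lintegral_indicator hEy]
  congr 1
  ext x
  by_cases hx : (x, y) ∈ E
  · rw [indicator_of_mem (by exact hx), indicator_of_mem hx]; simp
  · rw [indicator_of_notMem (by exact hx), indicator_of_notMem hx]; simp

lemma lint_scale {m : ℕ} (F : (Fin m → ℂ) → ENNReal) (hF : Measurable F) (r : ℝ) (hr : 0 < r)
    (x0 : ℂ) :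
    ∫⁻ z, F z = ENNReal.ofReal (r ^ (2 * m)) * ∫⁻ z : Fin m → ℂ, F (fun i => x0 + r * z i) := by
  have h1 : ∫⁻ z : Fin m → ℂ, F ((fun _ => x0) + z) = ∫⁻ z, F z :=
    lintegral_add_left_eq_self F (fun _ => x0)
  have h2 := lintegral_map (μ := (volume : Measure (Fin m → ℂ)))
    (f := fun z => F ((fun _ => x0) + z)) (g := fun z : Fin m → ℂ => r • z) (by fun_prop) (by fun_prop)
  rw [Measure.map_addHaar_smul _ hr.ne', lintegral_smul_measure, h1] at h2
  have hfin : Module.finrank ℝ (Fin m → ℂ) = 2 * m := by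
    rw [Module.finrank_pi_fintype]; simp [mul_comm]
  rw [hfin] at h2
  have h3 : ∀ z : Fin m → ℂ, (fun i => x0 + r * z i) = (fun _ => x0) + r • z := by
    intro z; ext i; simp
  simp_rw [h3]
  rw [← h2, smul_eq_mul, ← mul_assoc, ← ENNReal.ofReal_mul (by positivity),
    abs_of_pos (by positivity), mul_inv_cancel₀ (by positivity)]
  simp

lemma pts_eq {m : ℕ} (z : Fin m → ℂ) : pts (k := m + 1) z = Fin.cons 0 z := by
  ext i
  refine Fin.cases ?_ (fun j => ?_) i
  · simp [pts]
  · simp [pts]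

lemma stepC {m : ℕ} (F : (Fin (m + 1) → ℂ) → ENNReal) (hF : Measurable F) (r : ℝ) (hr : 0 < r) :
    ∫⁻ x, F x = ENNReal.ofReal (r ^ (2 * m)) *
      ∫⁻ z : Fin m → ℂ, ∫⁻ x : ℂ, F (fun i => x + r * pts (k := m + 1) z i) := by
  have h := (volume_preserving_piFinSuccAbove (fun _ : Fin (m+1) => ℂ) 0).symm
  rw [← h.lintegral_comp_emb (MeasurableEquiv.measurableEmbedding _), Measure.volume_eq_prod,
    lintegral_prod _ (by fun_prop)]
  have h4 : ∀ x : ℂ, ∫⁻ y : Fin m → ℂ, F ((MeasurableEquiv.piFinSuccAbove (fun _ => ℂ) 0).symm (x, y))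
    = ENNReal.ofReal (r ^ (2 * m)) *
      ∫⁻ z : Fin m → ℂ, F (fun i => x + r * pts (k := m + 1) z i) := by
    intro x
    rw [lint_scale _ (by fun_prop) r hr x]
    congr 2
    ext z
    congr 1
    rw [pts_eq]
    ext i
    refine Fin.cases ?_ (fun j => ?_) i
    · simp [MeasurableEquiv.piFinSuccAbove]
    · simp [MeasurableEquiv.piFinSuccAbove]
  have hm : Measurable fun p : ℂ × (Fin m → ℂ) => F (fun i => p.1 + r * pts (k := m + 1) p.2 i) := by
    refine hF.comp (measurable_pi_lambda _ fun i => ?_)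
    simp_rw [pts_eq]
    refine Fin.cases ?_ (fun j => ?_) i
    · simp; fun_prop
    · simp; fun_prop
  calc _ = ∫⁻ x : ℂ, ENNReal.ofReal (r ^ (2 * m)) *
      ∫⁻ z : Fin m → ℂ, F (fun i => x + r * pts (k := m + 1) z i) := by
        refine lintegral_congr fun x => h4 x
    _ = _ := by
      rw [lintegral_const_mul _ (Measurable.lintegral_prod_right hm)]
      congr 1
      exact lintegral_lintegral_swap hm.aemeasurable

lemma closed_sector (a r : ℝ) :
    IsClosed {q : (ℂ × ℝ) × ℂ | q.2 ∈ sector a q.1.1 q.1.2 r} := by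
  have h1 : IsClosed {q : Set.Icc (0:ℝ) a × ((ℂ × ℝ) × ℂ) | ‖q.2.2 - q.2.1.1‖ ≤ r ∧
      q.2.2 - q.2.1.1 = (‖q.2.2 - q.2.1.1‖ : ℂ) *
        Complex.exp (((q.2.1.2 + (q.1 : ℝ) : ℝ) : ℂ) * Complex.I)} := by
    rw [ofPred_and]
    refine IsClosed.inter (isClosed_le ?_ ?_) (isClosed_eq ?_ ?_) <;> fun_prop
  have h2 := isClosedMap_snd_of_compactSpace _ h1
  convert h2 using 1
  ext q
  simp only [sector, mem_ofPred_eq, Set.mem_image, Prod.exists, exists_eq_right, Subtype.exists]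
  constructor
  · rintro ⟨h, t, h1, h2, h3⟩
    refine ⟨t - q.1.2, ⟨by linarith, by linarith⟩, h, ?_⟩
    rw [h3]
    simp
  · rintro ⟨t, ⟨h1, h2⟩, h, h3⟩
    exact ⟨h, q.1.2 + t, by linarith, by linarith, h3⟩

lemma meas_arc (a r : ℝ) {n : ℕ} (i j : Fin n) :
    MeasurableSet {p : (Fin n → ℂ) × (Fin n → ℝ) | arc a r p.1 p.2 i j} := by
  by_cases hij : i = j
  · simp [arc, hij]
  · simp only [arc, ne_eq, hij, not_false_eq_true, true_and]
    exact (closed_sector a r).measurableSet.preimage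
      (f := fun p : (Fin n → ℂ) × (Fin n → ℝ) => ((p.1 i, p.2 i), p.1 j)) (by fun_prop)

lemma meas_iso (a r : ℝ) {k : ℕ} (T : Fin k → Fin k → Prop) :
    MeasurableSet {p : (Fin k → ℂ) × (Fin k → ℝ) | isoT a r T p.1 p.2} := by
  simp only [isoT, ofPred_exists, ofPred_forall]
  refine MeasurableSet.iUnion fun e => MeasurableSet.iInter fun i => MeasurableSet.iInter fun j => ?_
  by_cases h : T i j
  · simp only [h, true_iff]; exact meas_arc a r _ _
  · simp only [h, false_iff]; exact (meas_arc a r _ _).compl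

lemma sector_scale (a r : ℝ) (hr : 0 < r) (x u v : ℂ) (y : ℝ) :
    (x + r * v) ∈ sector a (x + r * u) y r ↔ v ∈ sector a u y 1 := by
  have h : x + r * v - (x + r * u) = r * (v - u) := by ring
  have hr' : (r : ℂ) ≠ 0 := by exact_mod_cast hr.ne'
  simp only [sector, mem_ofPred_eq, h, norm_mul, Complex.norm_real, Real.norm_eq_abs, abs_of_pos hr]
  constructor
  · rintro ⟨h1, t, h2, h3, h4⟩
    refine ⟨by nlinarith, t, h2, h3, ?_⟩
    apply mul_left_cancel₀ hr'
    rw [h4]; push_cast; ring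
  · rintro ⟨h1, t, h2, h3, h4⟩
    refine ⟨by nlinarith, t, h2, h3, ?_⟩
    push_cast
    rw [mul_assoc, ← h4]

lemma iso_scale (a r : ℝ) (hr : 0 < r) {k : ℕ} (T : Fin k → Fin k → Prop) (x : ℂ)
    (z : Fin k → ℂ) (y : Fin k → ℝ) :
    isoT a r T (fun i => x + r * z i) y ↔ isoT a 1 T z y := by
  simp only [isoT, arc, sector_scale a r hr]

lemma iso_bound (a : ℝ) {k : ℕ} (T : Fin k → Fin k → Prop)
    (hT : (SimpleGraph.fromRel T).Connected) (x : Fin k → ℂ) (y : Fin k → ℝ)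
    (h : isoT a 1 T x y) (i j : Fin k) : ‖x i - x j‖ ≤ k := by
  obtain ⟨e, he⟩ := h
  have key : ∀ u v : Fin k, ∀ p : (SimpleGraph.fromRel T).Walk u v,
      ‖x (e u) - x (e v)‖ ≤ p.length := by
    intro u v p
    induction p with
    | nil => simp
    | @cons u v w hadj p ih =>
      have h1 : ‖x (e u) - x (e v)‖ ≤ 1 := by
        rw [SimpleGraph.fromRel_adj] at hadj
        rcases hadj.2 with h | h
        · rw [norm_sub_rev]; exact ((he _ _).1 h).2.1
        · exact ((he _ _).1 h).2.1
      calc _ ≤ ‖x (e u) - x (e v)‖ + ‖x (e v) - x (e w)‖ := norm_sub_le_norm_sub_add_norm_sub _ _ _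
        _ ≤ _ := by push_cast [SimpleGraph.Walk.length_cons]; linarith
  obtain ⟨p, hp⟩ := (hT.preconnected (e.symm i) (e.symm j)).exists_isPath
  have h1 := key _ _ p
  have h2 := hp.length_lt
  simp only [Equiv.apply_symm_apply, Fintype.card_fin] at h1 h2
  refine h1.trans ?_
  exact_mod_cast h2.le

lemma count_iff (a r : ℝ) {k n : ℕ} (T : Fin k → Fin k → Prop) (x : Fin n → ℂ) (y : Fin n → ℝ)
    (g0 : Fin k ↪ Fin n) :
    (∃ g : Fin k ↪ Fin n, Finset.univ.map g = Finset.univ.map g0 ∧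
      ∀ i j, T i j ↔ arc a r x y (g i) (g j)) ↔ isoT a r T (fun i => x (g0 i)) (fun i => y (g0 i)) := by
  constructor
  · rintro ⟨g, hg, h⟩
    have h1 : ∀ i, ∃ j, g0 j = g i := by
      intro i
      have : g i ∈ Finset.univ.map g0 := by rw [← hg]; simp
      simpa using this
    choose e he using h1
    have hinj : Function.Injective e := by
      intro i j hij
      apply g.injective
      rw [← he, ← he, hij]
    refine ⟨Equiv.ofBijective e (Finite.injective_iff_bijective.1 hinj), fun i j => ?_⟩
    rw [h]
    simp only [arc, Equiv.ofBijective_apply, he, hinj.ne_iff, g.injective.ne_iff]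
  · rintro ⟨e, h⟩
    refine ⟨e.toEmbedding.trans g0, ?_, fun i j => ?_⟩
    · rw [← Finset.map_map]; simp
    · rw [h]; simp [arc]

open Classical in
lemma count_sum (a r : ℝ) {k n : ℕ} (T : Fin k → Fin k → Prop) (x : Fin n → ℂ) (y : Fin n → ℝ) :
    inducedCount a r T x y = ∑ s : {s : Finset (Fin n) // s.card = k},
      if isoT a r T (fun i => x (s.1.orderEmbOfFin s.2 i)) (fun i => y (s.1.orderEmbOfFin s.2 i))
      then 1 else 0 := by
  rw [inducedCount, Finset.sum_boole, ← Set.ncard_coe_finset]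
  rw [← Set.ncard_image_of_injective _ (Subtype.val_injective)]
  simp only [Nat.cast_id]
  congr 1
  ext s
  simp only [mem_ofPred_eq, Set.mem_image, Finset.coe_filter, Finset.mem_univ, true_and,
    Subtype.exists]
  constructor
  · rintro ⟨g, hg, h⟩
    have hc : s.card = k := by rw [← hg]; simp
    refine ⟨s, ?_⟩
    refine ⟨hc, ?_, rfl⟩
    refine (count_iff a r T x y (s.orderEmbOfFin hc).toEmbedding).1 ⟨g, ?_, h⟩
    rw [hg, Finset.map_orderEmbOfFin_univ]
  · rintro ⟨s', hc, h, rfl⟩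
    obtain ⟨g, hg, h⟩ := (count_iff a r T x y (s'.orderEmbOfFin hc).toEmbedding).2 h
    refine ⟨g, ?_, h⟩
    rw [hg, Finset.map_orderEmbOfFin_univ]

lemma ind_le_one {α : Type*} (E : Set α) (x : α) : E.indicator (1 : α → ENNReal) x ≤ 1 := by
  by_cases h : x ∈ E <;> simp [h]

lemma expect_count {Ω : Type} [MeasureSpace Ω] [IsProbabilityMeasure (ℙ : Measure Ω)]
    (a r : ℝ) (Z : ℕ → Ω → ℂ × ℝ) (hZm : ∀ i, Measurable (Z i)) (hZi : iIndepFun Z ℙ)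
    (ν : Measure (ℂ × ℝ)) (hZd : ∀ i, Measure.map (Z i) ℙ = ν)
    (k n : ℕ) (T : Fin k → Fin k → Prop) :
    ∫ ω, (inducedCount a r T
          (fun i : Fin n => (Z i ω).1) (fun i : Fin n => (Z i ω).2) : ℝ) ∂ℙ =
      (n.choose k : ℝ) * (Measure.pi (fun _ : Fin k => ν)
        {w | isoT a r T (fun i => (w i).1) (fun i => (w i).2)}).toReal := by
  classical
  have hS : MeasurableSet {w : Fin k → ℂ × ℝ | isoT a r T (fun i => (w i).1) (fun i => (w i).2)} :=
    (meas_iso a r T).preimage (f := fun w : Fin k → ℂ × ℝ => ((fun i => (w i).1), fun i => (w i).2))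
      (by fun_prop)
  set S := {w : Fin k → ℂ × ℝ | isoT a r T (fun i => (w i).1) (fun i => (w i).2)} with hSdef
  have hmap : ∀ s : {s : Finset (Fin n) // s.card = k},
      Measure.map (fun ω (i : Fin k) => Z (s.1.orderEmbOfFin s.2 i) ω) ℙ =
        Measure.pi (fun _ : Fin k => ν) := by
    intro s
    have hinj : Function.Injective (fun i : Fin k => ((s.1.orderEmbOfFin s.2 i : Fin n) : ℕ)) :=
      Fin.val_injective.comp (s.1.orderEmbOfFin s.2).injective
    have h := hZi.precomp hinj
    rw [iIndepFun_iff_map_fun_eq_pi_map (fun i => (hZm _).aemeasurable)] at h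
    rw [h]
    simp_rw [hZd]
  have hm : ∀ s : {s : Finset (Fin n) // s.card = k},
      Measurable (fun ω (i : Fin k) => Z (s.1.orderEmbOfFin s.2 i) ω) :=
    fun s => measurable_pi_lambda _ fun i => hZm _
  have h1 : ∀ ω, (inducedCount a r T
          (fun i : Fin n => (Z i ω).1) (fun i : Fin n => (Z i ω).2) : ℝ) =
      ∑ s : {s : Finset (Fin n) // s.card = k},
        ((fun ω (i : Fin k) => Z (s.1.orderEmbOfFin s.2 i) ω) ⁻¹' S).indicator (fun _ => (1 : ℝ)) ω := by
    intro ω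
    rw [count_sum]
    push_cast
    refine Finset.sum_congr rfl fun s _ => ?_
    simp [hSdef, Set.indicator_apply]
  simp_rw [h1]
  rw [integral_finsetSum]
  · have : ∀ s : {s : Finset (Fin n) // s.card = k},
      ∫ ω, ((fun ω (i : Fin k) => Z (s.1.orderEmbOfFin s.2 i) ω) ⁻¹' S).indicator
        (fun _ => (1 : ℝ)) ω ∂ℙ = (Measure.pi (fun _ : Fin k => ν) S).toReal := by
      intro s
      rw [integral_indicator_const _ ((hm s) hS), ← hmap s, Measure.map_apply (hm s) hS]
      simp [Measure.real]
    simp_rw [this]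
    simp
  · intro s _
    exact (integrable_const (1 : ℝ)).indicator ((hm s) hS)

lemma limit_G {m : ℕ} (f : ℂ → ℝ) (hf0 : ∀ x, 0 ≤ f x) (C : ℝ) (hC : ∀ x, f x ≤ C)
    (g : ℂ → ENNReal) (hgm : Measurable g) (hgle : ∀ x, g x ≤ ENNReal.ofReal C)
    (hgf : ∀ᵐ x, g x = ENNReal.ofReal (f x))
    (hfc : ∀ᵐ x : ℂ, ContinuousAt f x) (hgi : ∫⁻ x, g x ≠ ⊤)
    (r : ℕ → ℝ) (hr0 : Tendsto r atTop (𝓝 0)) (z : Fin m → ℂ) :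
    Tendsto (fun n => ∫⁻ x : ℂ, ∏ i, g (x + r n * pts (k := m + 1) z i)) atTop
      (𝓝 (∫⁻ x, ENNReal.ofReal (f x) ^ (m + 1))) := by
  refine tendsto_lintegral_of_dominated_convergence (fun x => g x * ENNReal.ofReal C ^ m) ?_ ?_ ?_ ?_
  · intro n
    exact Finset.measurable_fun_prod _ (fun i _ => hgm.comp (by fun_prop))
  · intro n
    refine Filter.Eventually.of_forall fun x => ?_
    simp only
    rw [Fin.prod_univ_succ]
    have h0 : pts (k := m + 1) z 0 = 0 := by simp [pts]
    rw [h0]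
    simp only [mul_zero, add_zero]
    gcongr
    calc _ ≤ ∏ i : Fin m, ENNReal.ofReal C := Finset.prod_le_prod' fun i _ => hgle _
      _ = _ := by simp
  · rw [lintegral_mul_const _ hgm]
    exact ENNReal.mul_ne_top hgi (by simp)
  · have h1 : ∀ᵐ x : ℂ, ∀ n, ∀ i : Fin (m+1),
        g (x + r n * pts (k := m + 1) z i) = ENNReal.ofReal (f (x + r n * pts (k := m + 1) z i)) := by
      rw [ae_all_iff]; intro n
      rw [ae_all_iff]; intro i
      exact (measurePreserving_add_right volume (r n * pts (k := m + 1) z i : ℂ)).quasiMeasurePreserving.ae hgf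
    filter_upwards [h1, hfc] with x hx hxc
    simp_rw [hx]
    have : ENNReal.ofReal (f x) ^ (m + 1) = ∏ i : Fin (m + 1), ENNReal.ofReal (f x) := by simp
    rw [this]
    have h2 : ∀ i : Fin (m+1), Tendsto (fun n => ENNReal.ofReal (f (x + r n * pts (k := m + 1) z i))) atTop
        (𝓝 (ENNReal.ofReal (f x))) := by
      intro i
      refine ENNReal.tendsto_ofReal (hxc.tendsto.comp ?_)
      have h3 : Tendsto (fun n => (r n : ℂ)) atTop (𝓝 0) := by
        have := (Complex.continuous_ofReal.tendsto 0).comp hr0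
        rw [Complex.ofReal_zero] at this
        exact this
      have h4 := (h3.mul_const (pts (k := m + 1) z i)).const_add x
      simpa using h4
    have h5 : Tendsto (fun n => fun i : Fin (m+1) => ENNReal.ofReal (f (x + r n * pts (k := m + 1) z i))) atTop
        (𝓝 (fun _ => ENNReal.ofReal (f x))) := tendsto_pi_nhds.2 h2
    clear h1
    have key : ∀ s : Finset (Fin (m+1)), Tendsto
        (fun n => ∏ i ∈ s, ENNReal.ofReal (f (x + r n * pts (k := m + 1) z i))) atTop
        (𝓝 (∏ i ∈ s, ENNReal.ofReal (f x))) := by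
      intro s
      induction s using Finset.induction_on with
      | empty => simp
      | insert i s hi ih =>
        simp_rw [Finset.prod_insert hi]
        refine ENNReal.Tendsto.mul (h2 i) (Or.inr ?_) ih (Or.inr (by simp))
        exact ENNReal.prod_ne_top fun _ _ => by simp
    exact key _

lemma limit_Q {m : ℕ} (a : ℝ) (T : Fin (m + 1) → Fin (m + 1) → Prop)
    (hT : (SimpleGraph.fromRel T).Connected)
    (f : ℂ → ℝ) (hf0 : ∀ x, 0 ≤ f x) (C : ℝ) (hC : ∀ x, f x ≤ C)
    (g : ℂ → ENNReal) (hgm : Measurable g) (hgle : ∀ x, g x ≤ ENNReal.ofReal C)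
    (hgf : ∀ᵐ x, g x = ENNReal.ofReal (f x))
    (hfc : ∀ᵐ x : ℂ, ContinuousAt f x) (hgi : ∫⁻ x, g x = 1)
    (r : ℕ → ℝ) (hr0 : Tendsto r atTop (𝓝 0)) (I : Set ℝ) (hI : volume I ≠ ⊤) :
    (∫⁻ y in Set.univ.pi (fun _ : Fin (m + 1) => I), ∫⁻ z : Fin m → ℂ,
      {p : (Fin (m+1) → ℂ) × (Fin (m+1) → ℝ) | isoT a 1 T p.1 p.2}.indicator 1 (pts (k := m + 1) z, y) ≠ ⊤) ∧
    Tendsto (fun n => ∫⁻ y in Set.univ.pi (fun _ : Fin (m + 1) => I), ∫⁻ z : Fin m → ℂ,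
      {p : (Fin (m+1) → ℂ) × (Fin (m+1) → ℝ) | isoT a 1 T p.1 p.2}.indicator 1 (pts (k := m + 1) z, y) *
      ∫⁻ x : ℂ, ∏ i, g (x + r n * pts (k := m + 1) z i)) atTop
      (𝓝 ((∫⁻ y in Set.univ.pi (fun _ : Fin (m + 1) => I), ∫⁻ z : Fin m → ℂ,
      {p : (Fin (m+1) → ℂ) × (Fin (m+1) → ℝ) | isoT a 1 T p.1 p.2}.indicator 1 (pts (k := m + 1) z, y)) *
       ∫⁻ x, ENNReal.ofReal (f x) ^ (m + 1))) := by
  have hE := meas_iso a 1 T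
  set E := {p : (Fin (m+1) → ℂ) × (Fin (m+1) → ℝ) | isoT a 1 T p.1 p.2} with hEdef
  have hpts : Measurable fun z : Fin m → ℂ => pts (k := m + 1) z := by
    simp_rw [pts_eq]
    refine measurable_pi_lambda _ fun i => ?_
    refine Fin.cases ?_ (fun j => ?_) i
    · simp
    · simp; fun_prop
  have h1m : Measurable (fun q : (Fin m → ℂ) × (Fin (m+1) → ℝ) =>
      E.indicator (1 : ((Fin (m+1) → ℂ) × (Fin (m+1) → ℝ)) → ENNReal) (pts (k := m + 1) q.1, q.2)) :=
    (measurable_one.indicator hE).comp ((hpts.comp measurable_fst).prodMk measurable_snd)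
  have hGm : ∀ n, Measurable fun z : Fin m → ℂ =>
      ∫⁻ x : ℂ, ∏ i, g (x + r n * pts (k := m + 1) z i) := by
    intro n
    refine Measurable.lintegral_prod_right' (f := fun q : (Fin m → ℂ) × ℂ =>
      ∏ i, g (q.2 + r n * pts (k := m + 1) q.1 i)) ?_
    refine Finset.measurable_fun_prod _ (fun i _ => hgm.comp ?_)
    have : Measurable fun q : (Fin m → ℂ) × ℂ => pts (k := m + 1) q.1 i :=
      (measurable_pi_apply i).comp (hpts.comp measurable_fst)
    fun_prop
  set B : Set (Fin m → ℂ) := Metric.closedBall 0 (m + 1 : ℝ) with hB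
  have hBv : volume B ≠ ⊤ := measure_closedBall_lt_top.ne
  have hBm : MeasurableSet B := measurableSet_closedBall
  have hind : ∀ z y, E.indicator (1 : ((Fin (m+1) → ℂ) × (Fin (m+1) → ℝ)) → ENNReal) (pts (k := m + 1) z, y) ≤ B.indicator 1 z := by
    intro z y
    by_cases h : (pts (k := m + 1) z, y) ∈ E
    · have hz : z ∈ B := by
        rw [hB, mem_closedBall_zero_iff, pi_norm_le_iff_of_nonneg (by positivity)]
        intro i
        have := iso_bound a T hT _ _ h i.succ 0
        rw [pts_eq] at this
        simpa using this
      rw [indicator_of_mem hz]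
      exact ind_le_one _ _
    · rw [indicator_of_notMem h]; simp
  have hGle : ∀ n z, ∫⁻ x : ℂ, ∏ i, g (x + r n * pts (k := m + 1) z i) ≤ ENNReal.ofReal C ^ m := by
    intro n z
    calc _ ≤ ∫⁻ x, g x * ENNReal.ofReal C ^ m := by
          refine lintegral_mono fun x => ?_
          rw [Fin.prod_univ_succ]
          have h0 : pts (k := m + 1) z 0 = 0 := by simp [pts]
          rw [h0]
          simp only [mul_zero, add_zero]
          gcongr
          calc _ ≤ ∏ i : Fin m, ENNReal.ofReal C := Finset.prod_le_prod' fun i _ => hgle _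
            _ = _ := by simp
      _ = _ := by rw [lintegral_mul_const _ hgm, hgi, one_mul]
  have hcube : volume (Set.univ.pi (fun _ : Fin (m + 1) => I)) ≠ ⊤ := by
    rw [volume_pi_pi]; exact ENNReal.prod_ne_top fun _ _ => hI
  have hBint : ∀ c : ENNReal, ∫⁻ z, B.indicator 1 z * c = volume B * c := by
    intro c
    rw [lintegral_mul_const _ (measurable_one.indicator hBm), lintegral_indicator_one hBm]
  constructor
  · refine ne_top_of_le_ne_top (b := volume B * volume (Set.univ.pi (fun _ : Fin (m + 1) => I)))
      (ENNReal.mul_ne_top hBv hcube) ?_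
    calc _ ≤ ∫⁻ y in Set.univ.pi (fun _ : Fin (m + 1) => I), volume B := by
          refine lintegral_mono fun y => ?_
          rw [← lintegral_indicator_one hBm]
          exact lintegral_mono fun z => hind z y
      _ = _ := by simp
  · have hM : ∀ z, Tendsto _ _ _ :=
      limit_G f hf0 C hC g hgm hgle hgf hfc (by simp [hgi]) r hr0 (m := m)
    have hMtop : ∫⁻ x, ENNReal.ofReal (f x) ^ (m + 1) ≠ ⊤ :=
      ne_top_of_le_ne_top (b := ENNReal.ofReal C ^ m) (by simp)
        (le_of_tendsto' (hM 0) fun n => hGle n 0)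
    rw [← lintegral_mul_const _ (Measurable.lintegral_prod_left h1m)]
    refine tendsto_lintegral_of_dominated_convergence (fun y => volume B * ENNReal.ofReal C ^ m)
      ?_ ?_ ?_ ?_
    · intro n
      exact Measurable.lintegral_prod_left (h1m.mul ((hGm n).comp measurable_fst))
    · intro n
      refine Filter.Eventually.of_forall fun y => ?_
      simp only
      rw [← hBint]
      exact lintegral_mono fun z => mul_le_mul' (hind z y) (hGle n z)
    · simp only [lintegral_const, Measure.restrict_apply_univ]
      exact ENNReal.mul_ne_top (ENNReal.mul_ne_top hBv (by simp)) hcube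
    · refine Filter.Eventually.of_forall fun y => ?_
      have h1y : Measurable fun z : Fin m → ℂ => E.indicator (1 : ((Fin (m+1) → ℂ) × (Fin (m+1) → ℝ)) → ENNReal) (pts (k := m + 1) z, y) :=
        (measurable_one.indicator hE).comp (hpts.prodMk measurable_const)
      rw [← lintegral_mul_const _ h1y]
      refine tendsto_lintegral_of_dominated_convergence
        (fun z => B.indicator 1 z * ENNReal.ofReal C ^ m) ?_ ?_ ?_ ?_
      · intro n
        exact h1y.mul (hGm n)
      · intro n
        exact Filter.Eventually.of_forall fun z => mul_le_mul' (hind z y) (hGle n z)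
      · rw [hBint]; exact ENNReal.mul_ne_top hBv (by simp)
      · refine Filter.Eventually.of_forall fun z => ?_
        refine ENNReal.Tendsto.const_mul (hM z) (Or.inr ?_)
        exact ((ind_le_one _ _).trans_lt ENNReal.one_lt_top).ne

/-- Proposition 1: asymptotics of the expected number of induced `T`-subdigraphs
when `rₙ → 0`. -/
theorem statement4
    {Ω : Type} [MeasureSpace Ω] [IsProbabilityMeasure (ℙ : Measure Ω)]
    -- the common density of the points, bounded and a.e. continuous
    (f : ℂ → ℝ) (hf0 : ∀ x, 0 ≤ f x) (hfb : ∃ C, ∀ x, f x ≤ C)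
    (hfc : ∀ᵐ x : ℂ, ContinuousAt f x)
    -- the central angle α ∈ (0, 2π]
    (a : ℝ) (ha : 0 < a) (ha' : a ≤ 2 * π)
    -- `Z i = (Xᵢ, Yᵢ)`: i.i.d., `Xᵢ` with density `f`, `Yᵢ` uniform on `[0, 2π)`,
    -- the `Xᵢ` independent of the `Yᵢ`
    (Z : ℕ → Ω → ℂ × ℝ) (hZm : ∀ i, Measurable (Z i))
    (hZi : iIndepFun Z ℙ)
    (hZd : ∀ i, Measure.map (Z i) ℙ =
      (volume.withDensity fun x => ENNReal.ofReal (f x)).prod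
        ((ENNReal.ofReal (2 * π))⁻¹ • volume.restrict (Set.Ico 0 (2 * π))))
    -- `T` a feasible connected digraph of order `k`
    (k : ℕ) (hk : 2 ≤ k) (T : Fin k → Fin k → Prop) (hTirr : ∀ i, ¬ T i i)
    (hTconn : (SimpleGraph.fromRel T).Connected)
    (hTfeas : ∃ ρ : ℝ, 0 < ρ ∧
      0 < ℙ {ω | isoT a ρ T (fun i : Fin k => (Z i ω).1) (fun i : Fin k => (Z i ω).2)})
    -- the positive cutoffs
    (r : ℕ → ℝ) (hrpos : ∀ n, 0 < r n)
    (hr0 : Tendsto r atTop (𝓝 0)) :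
    Tendsto (fun n : ℕ =>
        (∫ ω, (inducedCount a (r n) T
          (fun i : Fin n => (Z i ω).1) (fun i : Fin n => (Z i ω).2) : ℝ) ∂ℙ) /
          ((n : ℝ) ^ k * r n ^ (2 * (k - 1))))
      atTop (𝓝 (muT a k T f)) := by
  obtain ⟨C, hC⟩ := hfb
  obtain ⟨m, rfl⟩ : ∃ m, k = m + 1 := ⟨k - 1, by omega⟩
  classical
  set D : Set ℂ := {x | ContinuousAt f x} with hD
  have hDm : MeasurableSet D := (IsGδ.setOfPred_continuousAt f).measurableSet
  have hfm : Measurable (D.piecewise f 0) := by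
    refine ContinuousOn.measurable_piecewise (fun x hx => ?_) continuousOn_const hDm
    exact ContinuousAt.continuousWithinAt hx
  set g : ℂ → ENNReal := fun x => ENNReal.ofReal (D.piecewise f 0 x) with hg
  have hgm : Measurable g := hfm.ennreal_ofReal
  have hC0 : 0 ≤ C := (hf0 0).trans (hC 0)
  have hgle : ∀ x, g x ≤ ENNReal.ofReal C := by
    intro x
    refine ENNReal.ofReal_le_ofReal ?_
    by_cases hx : x ∈ D
    · simpa [hx] using hC x
    · simpa [hx] using hC0
  have hgf : ∀ᵐ x, g x = ENNReal.ofReal (f x) := by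
    filter_upwards [hfc] with x hx
    have : x ∈ D := hx
    simp [hg, this]
  have hpi : 0 < 2 * π := by positivity
  have hwd : (volume.withDensity fun x => ENNReal.ofReal (f x)) = volume.withDensity g :=
    withDensity_congr_ae (hgf.mono fun x hx => hx.symm)
  rw [hwd] at hZd
  have hgi : ∫⁻ x, g x = 1 := by
    have h1 : Measure.map (Z 0) ℙ univ = 1 := by
      rw [Measure.map_apply (hZm 0) MeasurableSet.univ]; simp
    rw [hZd 0, ← univ_prod_univ, Measure.prod_prod, withDensity_apply _ MeasurableSet.univ] at h1
    simp only [Measure.restrict_univ, Measure.smul_apply, Measure.restrict_apply_univ, smul_eq_mul,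
      Real.volume_Ico, sub_zero] at h1
    rwa [ENNReal.inv_mul_cancel (by simpa using hpi) ENNReal.ofReal_ne_top, mul_one] at h1
  have hfinm : IsFiniteMeasure ((volume : Measure ℂ).withDensity g) :=
    isFiniteMeasure_withDensity (by simp [hgi])
  have hI : volume (Set.Ico 0 (2 * π)) ≠ ⊤ := by
    rw [Real.volume_Ico]; exact ENNReal.ofReal_ne_top
  have hc : (ENNReal.ofReal (2 * π))⁻¹ ≠ ⊤ := by simpa using hpi
  obtain ⟨hQtop, hQ⟩ := limit_Q a T hTconn f hf0 C hC g hgm hgle hgf hfc hgi r hr0 _ hI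
  set E := {p : (Fin (m+1) → ℂ) × (Fin (m+1) → ℝ) | isoT a 1 T p.1 p.2} with hEdef
  set Q : ℕ → ENNReal := fun n => ∫⁻ y in Set.univ.pi (fun _ : Fin (m + 1) => Set.Ico 0 (2 * π)),
    ∫⁻ z : Fin m → ℂ, E.indicator 1 (pts (k := m + 1) z, y) *
      ∫⁻ x : ℂ, ∏ i, g (x + r n * pts (k := m + 1) z i) with hQdef
  have hMtop : ∫⁻ x, ENNReal.ofReal (f x) ^ (m + 1) ≠ ⊤ := by
    refine ne_top_of_le_ne_top (b := ∫⁻ x, g x * ENNReal.ofReal C ^ m) ?_ ?_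
    · rw [lintegral_mul_const _ hgm, hgi]; simp
    · refine lintegral_mono_ae ?_
      filter_upwards [hgf] with x hx
      rw [pow_succ', ← hx]
      gcongr
      exact hgle x
  have hprob : ∀ n, Measure.pi (fun _ : Fin (m+1) => ((volume : Measure ℂ).withDensity g).prod
      ((ENNReal.ofReal (2 * π))⁻¹ • volume.restrict (Set.Ico 0 (2 * π))))
        {w | isoT a (r n) T (fun i => (w i).1) (fun i => (w i).2)} =
      (ENNReal.ofReal (2 * π))⁻¹ ^ (m + 1) * (ENNReal.ofReal (r n ^ (2 * m)) * Q n) := by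
    intro n
    have h1 := stepB g hgm _ hc _ hI _ (meas_iso a (r n) T)
    refine h1.trans ?_
    congr 1
    rw [hQdef]
    simp only
    rw [← lintegral_const_mul' _ _ (by simp)]
    refine lintegral_congr fun y => ?_
    have hmeas : Measurable fun x : Fin (m+1) → ℂ =>
        {p : (Fin (m+1) → ℂ) × (Fin (m+1) → ℝ) | isoT a (r n) T p.1 p.2}.indicator
          (1 : ((Fin (m+1) → ℂ) × (Fin (m+1) → ℝ)) → ENNReal) (x, y) * ∏ i, g (x i) := by
      refine Measurable.mul ((measurable_one.indicator (meas_iso a (r n) T)).comp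
        (measurable_id.prodMk measurable_const)) ?_
      exact Finset.measurable_fun_prod _ (fun i _ => hgm.comp (measurable_pi_apply i))
    rw [stepC _ hmeas (r n) (hrpos n)]
    congr 1
    refine lintegral_congr fun z => ?_
    rw [← lintegral_const_mul' _ _ ((ind_le_one _ _).trans_lt ENNReal.one_lt_top).ne]
    refine lintegral_congr fun x => ?_
    congr 1
    simp only [Set.indicator_apply, hEdef, Set.mem_ofPred_eq, iso_scale a (r n) (hrpos n)]
    rfl
  have hmu : muT a (m + 1) T f = 1 / ((m + 1).factorial : ℝ) * (((ENNReal.ofReal (2 * π))⁻¹ ^ (m + 1)).toReal *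
      ((∫⁻ y in Set.univ.pi (fun _ : Fin (m + 1) => Set.Ico 0 (2 * π)), ∫⁻ z : Fin m → ℂ,
        E.indicator 1 (pts (k := m + 1) z, y)) * ∫⁻ x, ENNReal.ofReal (f x) ^ (m + 1)).toReal) := by
    have hpts : Measurable fun z : Fin m → ℂ => pts (k := m + 1) z := by
      simp_rw [pts_eq]
      refine measurable_pi_lambda _ fun i => ?_
      refine Fin.cases ?_ (fun j => ?_) i
      · simp
      · simp; fun_prop
    have h1m : Measurable (fun q : (Fin m → ℂ) × (Fin (m+1) → ℝ) =>
        E.indicator (1 : ((Fin (m+1) → ℂ) × (Fin (m+1) → ℝ)) → ENNReal) (pts (k := m + 1) q.1, q.2)) :=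
      (measurable_one.indicator (meas_iso a 1 T)).comp ((hpts.comp measurable_fst).prodMk measurable_snd)
    have hF : ∫ x : ℂ, f x ^ (m + 1) = (∫⁻ x, ENNReal.ofReal (f x) ^ (m + 1)).toReal := by
      rw [integral_eq_lintegral_of_nonneg_ae]
      · simp_rw [ENNReal.ofReal_pow (hf0 _)]
      · exact Filter.Eventually.of_forall fun x => pow_nonneg (hf0 x) _
      · refine AEStronglyMeasurable.pow ?_ _
        refine ⟨_, hfm.stronglyMeasurable, ?_⟩
        filter_upwards [hfc] with x hx
        have : x ∈ D := hx
        simp [this]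
    have hz : ∀ y : Fin (m+1) → ℝ, ∫ z : Fin m → ℂ, hInd a T (pts (k := m + 1) z) y =
        (∫⁻ z : Fin m → ℂ, E.indicator 1 (pts (k := m + 1) z, y)).toReal := by
      intro y
      have h2 : ∀ z : Fin m → ℂ, hInd a T (pts (k := m + 1) z) y =
          (E.indicator (1 : ((Fin (m+1) → ℂ) × (Fin (m+1) → ℝ)) → ENNReal) (pts (k := m + 1) z, y)).toReal := by
        intro z
        by_cases h : isoT a 1 T (pts (k := m + 1) z) y
        · have h' : (pts (k := m + 1) z, y) ∈ E := h
          simp [hInd, h, h']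
        · have h' : (pts (k := m + 1) z, y) ∉ E := h
          simp [hInd, h, h']
      simp_rw [h2]
      refine integral_toReal ?_ ?_
      · exact ((measurable_one.indicator (meas_iso a 1 T)).comp
          (hpts.prodMk measurable_const)).aemeasurable
      · exact Filter.Eventually.of_forall fun z => (ind_le_one _ _).trans_lt ENNReal.one_lt_top
    have hy : ∫ y in Set.univ.pi (fun _ : Fin (m + 1) => Set.Ico 0 (2 * π)),
        ∫ z : Fin m → ℂ, hInd a T (pts (k := m + 1) z) y =
        (∫⁻ y in Set.univ.pi (fun _ : Fin (m + 1) => Set.Ico 0 (2 * π)), ∫⁻ z : Fin m → ℂ,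
          E.indicator 1 (pts (k := m + 1) z, y)).toReal := by
      simp_rw [hz]
      refine integral_toReal ?_ ?_
      · exact (Measurable.lintegral_prod_left h1m).aemeasurable
      · exact ae_lt_top (Measurable.lintegral_prod_left h1m) hQtop
    rw [ENNReal.toReal_mul, ← hF, ← hy, muT]
    have h3 : ∀ y : Fin (m+1) → ℝ, ∫ z : Fin (m + 1 - 1) → ℂ, ∫ x : ℂ, hInd a T (pts z) y * f x ^ (m + 1) =
        (∫ z : Fin m → ℂ, hInd a T (pts (k := m + 1) z) y) * ∫ x : ℂ, f x ^ (m + 1) := by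
      intro y
      simp_rw [integral_const_mul, integral_mul_const]
      rfl
    simp_rw [h3]
    rw [integral_mul_const, ENNReal.toReal_pow, ENNReal.toReal_inv, ENNReal.toReal_ofReal hpi.le, inv_pow,
      one_div, one_div, mul_inv]
    ring
  have hlim : Tendsto (fun n : ℕ => ((n.choose (m + 1) : ℝ) / (n : ℝ) ^ (m + 1)) *
      (((ENNReal.ofReal (2 * π))⁻¹ ^ (m + 1)).toReal * (Q n).toReal)) atTop (𝓝 (muT a (m + 1) T f)) := by
    rw [hmu]
    refine Tendsto.mul ?_ (Tendsto.const_mul _ ?_)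
    · have h0 : Tendsto (fun n : ℕ => (n : ℝ) * (n : ℝ)⁻¹) atTop (𝓝 1) := by
        refine tendsto_const_nhds.congr' ?_
        filter_upwards [eventually_gt_atTop 0] with n hn
        rw [mul_inv_cancel₀ (by positivity)]
      have h1 := tendsto_choose_mul_pow_atTop (m + 1) h0
      simp only [one_pow, inv_pow] at h1
      simpa only [div_eq_mul_inv] using h1
    · exact (ENNReal.tendsto_toReal (ENNReal.mul_ne_top hQtop hMtop)).comp hQ
  refine hlim.congr fun n => ?_
  rw [expect_count a (r n) Z hZm hZi _ hZd (m + 1) n T, hprob n, ENNReal.toReal_mul,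
    ENNReal.toReal_mul, ENNReal.toReal_ofReal (by have := hrpos n; positivity)]
  have hrn : r n ^ (2 * m) ≠ 0 := pow_ne_zero _ (hrpos n).ne'
  simp only [Nat.add_sub_cancel]
  rw [mul_comm ((n : ℝ) ^ (m + 1)), ← div_div]
  have : (n.choose (m + 1) : ℝ) * (((ENNReal.ofReal (2 * π))⁻¹ ^ (m + 1)).toReal *
      (r n ^ (2 * m) * (Q n).toReal)) / r n ^ (2 * m) =
      (n.choose (m + 1) : ℝ) * (((ENNReal.ofReal (2 * π))⁻¹ ^ (m + 1)).toReal * (Q n).toReal) := by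
    rw [div_eq_iff hrn]; ring
  rw [this]; ring


end
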